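/- Let Λ* ⊆ (F⁺_d)^N be a factorial language and let ∅ ≠ F ⊆ [N], with F^c := [N] \ F. The following are equivalent: (i) there exists a ∈ K_F with a Q_{F^c} ≠ 0; (ii) there exists a ∈ A with a Q_{F^c} = Q_{∅̄}; (iii) for every i ∈ F and k ∈ [d] with δ_i(k) ∈ Λ* there exists μ̄ ∈ Λ* such that μ̄ * δ_i(k) ∉ Λ*. -/

import Mathlib

open scoped ENNReal

/-- The `N`-fold direct product of the free monoid on `d` generators,
with coordinatewise multiplication. -/
abbrev MWord (d N : ℕ) : Type := Fin N → FreeMonoid (Fin d)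

/-- The element of `(F⁺_d)^N` whose `i`-th coordinate is the one-letter word `k`
and whose other coordinates are empty. -/
def delta (d N : ℕ) (i : Fin N) (k : Fin d) : MWord d N :=
  fun j => if j = i then FreeMonoid.of k else 1

/-- `ν` is a factor of `μ` if `μ = w * ν * q` for some `w, q`. -/
def IsFactor {d N : ℕ} (ν μ : MWord d N) : Prop :=
  ∃ w q : MWord d N, μ = w * ν * q

/-- A factorial language in `(F⁺_d)^N`. -/
def IsFL {d N : ℕ} (Λ : Set (MWord d N)) : Prop :=
  (∀ i : Fin N, ∃ k : Fin d, delta d N i k ∈ Λ) ∧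
  ∀ μ ∈ Λ, ∀ ν : MWord d N, IsFactor ν μ → ν ∈ Λ

/-- The multilength of a multiword. -/
def mlen {d N : ℕ} (μ : MWord d N) : Fin N → ℕ := fun i => (μ i).length

/-- The support of a multiword. -/
def msupp {d N : ℕ} (μ : MWord d N) : Set (Fin N) := {i | μ i ≠ 1}

noncomputable section

/-- The Hilbert space `ℓ²(Λ*)`. -/
abbrev ell2 {d N : ℕ} (Λ : Set (MWord d N)) : Type := lp (fun _ : Λ => ℂ) 2

/-- The standard orthonormal basis vector `e_w̄` of `ℓ²(Λ*)`. -/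
def evec {d N : ℕ} (Λ : Set (MWord d N)) (w : Λ) : ell2 Λ :=
  letI := Classical.decEq (↥Λ)
  lp.single 2 w 1

end

noncomputable section

/-- The C*-algebra of checkers of a factorial language: the unital commutative C*-subalgebra
of `B(ℓ²(Λ*))` generated by the projections `T_μ̄* T_μ̄`, `μ̄ ∈ Λ*`. -/
def checkers {d N : ℕ} (Λ : Set (MWord d N)) (T : MWord d N → (ell2 Λ →L[ℂ] ell2 Λ)) :
    StarSubalgebra ℂ (ell2 Λ →L[ℂ] ell2 Λ) :=
  (StarAlgebra.adjoin ℂ {x : ell2 Λ →L[ℂ] ell2 Λ | ∃ μ ∈ Λ, x = star (T μ) * T μ}).topologicalClosure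

/-- `P_i = Σ_{k∈[d]} T_{δ_i(k)} T_{δ_i(k)}*`. -/
def Pproj {d N : ℕ} (Λ : Set (MWord d N)) (T : MWord d N → (ell2 Λ →L[ℂ] ell2 Λ))
    (i : Fin N) : ell2 Λ →L[ℂ] ell2 Λ :=
  ∑ k : Fin d, T (delta d N i k) * star (T (delta d N i k))

/-- `Q_F = Π_{i∈F} (I − P_i)`, the product taken in the increasing order of `[N]`
(the factors pairwise commute, so the order is immaterial); `Q_∅ = I`. -/
def Qproj {d N : ℕ} (Λ : Set (MWord d N)) (T : MWord d N → (ell2 Λ →L[ℂ] ell2 Λ))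
    (F : Finset (Fin N)) : ell2 Λ →L[ℂ] ell2 Λ :=
  ((List.finRange N).filter (· ∈ F)).foldr (fun i acc => (1 - Pproj Λ T i) * acc) 1

/-- `K_F = { a ∈ A : α_{δ_i(k)}(a) = 0 for all i ∈ F, k ∈ [d] }`. -/
def Kset {d N : ℕ} (Λ : Set (MWord d N)) (T : MWord d N → (ell2 Λ →L[ℂ] ell2 Λ))
    (F : Finset (Fin N)) : Set (ell2 Λ →L[ℂ] ell2 Λ) :=
  {a | a ∈ checkers Λ T ∧
    ∀ i ∈ F, ∀ k : Fin d, star (T (delta d N i k)) * a * T (delta d N i k) = 0}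

/-- `J_F = { a ∈ A : a b = 0 for all b ∈ K_F }`. -/
def Jset {d N : ℕ} (Λ : Set (MWord d N)) (T : MWord d N → (ell2 Λ →L[ℂ] ell2 Λ))
    (F : Finset (Fin N)) : Set (ell2 Λ →L[ℂ] ell2 Λ) :=
  {a | a ∈ checkers Λ T ∧ ∀ b ∈ Kset Λ T F, a * b = 0}

/-- `I_F = { a ∈ J_F : α_μ̄(a) ∈ J_F for all μ̄ ∈ Λ* with supp μ̄ ∩ F = ∅ }`. -/
def Iset {d N : ℕ} (Λ : Set (MWord d N)) (T : MWord d N → (ell2 Λ →L[ℂ] ell2 Λ))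
    (F : Finset (Fin N)) : Set (ell2 Λ →L[ℂ] ell2 Λ) :=
  {a | a ∈ Jset Λ T F ∧
    ∀ μ ∈ Λ, msupp μ ∩ (↑F : Set (Fin N)) = ∅ → star (T μ) * a * T μ ∈ Jset Λ T F}

end

noncomputable section

section

variable {d N : ℕ} {Λ : Set (MWord d N)}

theorem evec_apply_self (w : Λ) : (evec Λ w : Λ → ℂ) w = 1 := by
  classical
  simp [evec]

theorem evec_apply_of_ne {v w : Λ} (h : v ≠ w) : (evec Λ w : Λ → ℂ) v = 0 := by
  classical
  simp [evec, h]

theorem evec_ne_zero (w : Λ) : evec Λ w ≠ 0 := fun h => by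
  have := evec_apply_self w
  rw [h] at this
  simp at this

theorem inner_evec_left (w : Λ) (x : ell2 Λ) : inner ℂ (evec Λ w) x = (x : Λ → ℂ) w := by
  classical
  have := lp.inner_single_left (𝕜 := ℂ) w (1 : ℂ) x
  simp only [RCLike.inner_apply, map_one, mul_one] at this
  rw [← this, evec]
  congr!

/-- Bounded operators on `ℓ²(Λ*)` agreeing on the standard basis are equal. -/
theorem ext_evec {a b : ell2 Λ →L[ℂ] ell2 Λ} (h : ∀ w, a (evec Λ w) = b (evec Λ w)) :
    a = b := by
  classical
  refine lp.ext_continuousLinearMap (by simp) fun w => ?_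
  ext1
  convert! h w using 2 <;> simp [evec] <;> congr!

theorem star_apply_evec (a : ell2 Λ →L[ℂ] ell2 Λ) (v w : Λ) :
    (star a (evec Λ w) : Λ → ℂ) v = star ((a (evec Λ v) : Λ → ℂ) w) := by
  rw [← inner_evec_left, ← inner_evec_left, ContinuousLinearMap.star_eq_adjoint,
    ContinuousLinearMap.adjoint_inner_right, RCLike.star_def, inner_conj_symm]

/-- An operator is diagonal with respect to the standard basis of `ℓ²(Λ*)`. -/
def IsDiag (a : ell2 Λ →L[ℂ] ell2 Λ) : Prop :=
  ∀ w : Λ, a (evec Λ w) = (a (evec Λ w) : Λ → ℂ) w • evec Λ w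

theorem isDiag_of_apply_eq_smul {a : ell2 Λ →L[ℂ] ell2 Λ} (c : Λ → ℂ)
    (h : ∀ w, a (evec Λ w) = c w • evec Λ w) : IsDiag a := fun w => by
  rw [h w, lp.coeFn_smul, Pi.smul_apply, evec_apply_self, smul_eq_mul, mul_one]

theorem apply_self_of_eq_smul {a : ell2 Λ →L[ℂ] ell2 Λ} {c : ℂ} {w : Λ}
    (h : a (evec Λ w) = c • evec Λ w) : (a (evec Λ w) : Λ → ℂ) w = c := by
  rw [h, lp.coeFn_smul, Pi.smul_apply, evec_apply_self, smul_eq_mul, mul_one]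

theorem IsDiag.star_apply {a : ell2 Λ →L[ℂ] ell2 Λ} (ha : IsDiag a) (w : Λ) :
    star a (evec Λ w) = star ((a (evec Λ w) : Λ → ℂ) w) • evec Λ w := by
  ext v
  rw [star_apply_evec, lp.coeFn_smul, Pi.smul_apply]
  by_cases h : v = w
  · subst h
    rw [evec_apply_self, smul_eq_mul, mul_one]
  · rw [ha v, lp.coeFn_smul, Pi.smul_apply, evec_apply_of_ne h, evec_apply_of_ne (Ne.symm h)]
    simp

/-- The diagonal operators whose diagonal entries at `u` and `v` agree. -/
def diagEq (u v : Λ) : StarSubalgebra ℂ (ell2 Λ →L[ℂ] ell2 Λ) where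
  carrier := {a | IsDiag a ∧ (a (evec Λ u) : Λ → ℂ) u = (a (evec Λ v) : Λ → ℂ) v}
  mul_mem' := by
    rintro a b ⟨ha, ha'⟩ ⟨hb, hb'⟩
    have key : ∀ w, (a * b) (evec Λ w) =
        ((b (evec Λ w) : Λ → ℂ) w * (a (evec Λ w) : Λ → ℂ) w) • evec Λ w := fun w => by
      rw [mul_apply_eq_comp, hb w, map_smul, ha w, smul_smul,
        ← hb w, ← ha w]
    refine ⟨isDiag_of_apply_eq_smul _ key, ?_⟩
    rw [apply_self_of_eq_smul (key u), apply_self_of_eq_smul (key v), ha', hb']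
  add_mem' := by
    rintro a b ⟨ha, ha'⟩ ⟨hb, hb'⟩
    have key : ∀ w, (a + b) (evec Λ w) =
        ((a (evec Λ w) : Λ → ℂ) w + (b (evec Λ w) : Λ → ℂ) w) • evec Λ w := fun w => by
      rw [add_smul, ← ha w, ← hb w, add_apply]
    refine ⟨isDiag_of_apply_eq_smul _ key, ?_⟩
    rw [apply_self_of_eq_smul (key u), apply_self_of_eq_smul (key v), ha', hb']
  algebraMap_mem' := by
    intro r
    have key : ∀ w, algebraMap ℂ (ell2 Λ →L[ℂ] ell2 Λ) r (evec Λ w) = r • evec Λ w :=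
      fun w => by simp [Algebra.algebraMap_eq_smul_one]
    refine ⟨isDiag_of_apply_eq_smul _ key, ?_⟩
    rw [apply_self_of_eq_smul (key u), apply_self_of_eq_smul (key v)]
  star_mem' := by
    rintro a ⟨ha, ha'⟩
    refine ⟨isDiag_of_apply_eq_smul _ ha.star_apply, ?_⟩
    rw [apply_self_of_eq_smul (ha.star_apply u), apply_self_of_eq_smul (ha.star_apply v), ha']

theorem continuous_entry (v w : Λ) :
    Continuous fun a : ell2 Λ →L[ℂ] ell2 Λ => (a (evec Λ w) : Λ → ℂ) v := by
  simp_rw [← inner_evec_left]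
  fun_prop

theorem isClosed_diagEq (u v : Λ) : IsClosed (diagEq u v : Set (ell2 Λ →L[ℂ] ell2 Λ)) := by
  have h : (diagEq u v : Set (ell2 Λ →L[ℂ] ell2 Λ)) =
      (⋂ w : Λ, {a | a (evec Λ w) = (a (evec Λ w) : Λ → ℂ) w • evec Λ w}) ∩
        {a | (a (evec Λ u) : Λ → ℂ) u = (a (evec Λ v) : Λ → ℂ) v} := by
    ext a
    simp [diagEq, IsDiag]
  rw [h]
  refine IsClosed.inter (isClosed_iInter fun w => isClosed_eq (by fun_prop) ?_)
    (isClosed_eq (continuous_entry u u) (continuous_entry v v))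
  exact (continuous_entry w w).smul continuous_const

theorem IsFL.right_mem (hFL : IsFL Λ) {μ w : MWord d N} (h : μ * w ∈ Λ) : w ∈ Λ :=
  hFL.2 _ h _ ⟨μ, 1, by rw [mul_one]⟩

theorem IsFL.left_mem (hFL : IsFL Λ) {μ w : MWord d N} (h : μ * w ∈ Λ) : μ ∈ Λ :=
  hFL.2 _ h _ ⟨1, w, by rw [one_mul]⟩

theorem exists_eq_delta_mul {w : MWord d N} {i : Fin N} (h : w i ≠ 1) :
    ∃ k v, w = delta d N i k * v := by
  obtain ⟨k, x, hx⟩ : ∃ k x, w i = FreeMonoid.of k * x := by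
    generalize w i = y at h
    induction y using FreeMonoid.casesOn with
    | one => exact absurd rfl h
    | of_mul k x => exact ⟨k, x, rfl⟩
  refine ⟨k, Function.update w i x, ?_⟩
  funext j
  by_cases hj : j = i
  · subst hj
    simp [delta, hx]
  · simp [delta, hj]

theorem delta_mul_apply_ne_one (i : Fin N) (k : Fin d) (v : MWord d N) :
    (delta d N i k * v) i ≠ 1 := by
  intro h
  have := congrArg FreeMonoid.length h
  simp [delta] at this

theorem delta_mul_letter_injective {i : Fin N} {k l : Fin d} {u v : MWord d N}
    (h : delta d N i k * u = delta d N i l * v) : k = l := by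
  have h1 := congrArg (fun w : MWord d N => FreeMonoid.toList (w i)) h
  simp only [delta, Pi.mul_apply, if_true, FreeMonoid.toList_of_mul, List.cons.injEq] at h1
  exact h1.1

section Operators

variable {T : MWord d N → (ell2 Λ →L[ℂ] ell2 Λ)}
  (hT1 : ∀ (μ : MWord d N) (w : Λ) (h : μ * (w : MWord d N) ∈ Λ),
    T μ (evec Λ w) = evec Λ ⟨μ * (w : MWord d N), h⟩)
  (hT2 : ∀ (μ : MWord d N) (w : Λ), μ * (w : MWord d N) ∉ Λ → T μ (evec Λ w) = 0)

include hT1 hT2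

theorem star_T_apply_mul (μ : MWord d N) (w : Λ) (h : μ * (w : MWord d N) ∈ Λ) :
    star (T μ) (evec Λ ⟨μ * (w : MWord d N), h⟩) = evec Λ w := by
  ext v
  rw [star_apply_evec]
  by_cases hv : μ * (v : MWord d N) ∈ Λ
  · rw [hT1 μ v hv]
    by_cases hvw : v = w
    · subst hvw
      rw [evec_apply_self, evec_apply_self, star_one]
    · rw [evec_apply_of_ne hvw, evec_apply_of_ne, star_zero]
      intro h'
      exact hvw (Subtype.ext (mul_left_cancel (congrArg Subtype.val h')).symm)
  · have hvw : v ≠ w := by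
      rintro rfl
      exact hv h
    rw [hT2 μ v hv, evec_apply_of_ne hvw]
    simp

theorem star_T_apply_of_forall_ne (μ : MWord d N) (w : Λ)
    (h : ∀ v : MWord d N, (w : MWord d N) ≠ μ * v) : star (T μ) (evec Λ w) = 0 := by
  ext v
  rw [star_apply_evec]
  by_cases hv : μ * (v : MWord d N) ∈ Λ
  · rw [hT1 μ v hv, evec_apply_of_ne]
    · simp
    · intro h'
      exact h v (congrArg Subtype.val h')
  · rw [hT2 μ v hv]
    simp

open Classical in
theorem star_T_mul_T_apply (μ : MWord d N) (w : Λ) :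
    (star (T μ) * T μ) (evec Λ w) = if μ * (w : MWord d N) ∈ Λ then evec Λ w else 0 := by
  rw [mul_apply_eq_comp]
  split_ifs with h
  · rw [hT1 μ w h, star_T_apply_mul hT1 hT2]
  · rw [hT2 μ w h, map_zero]

theorem checkers_le_diagEq (u v : Λ)
    (huv : ∀ μ ∈ Λ, μ * (u : MWord d N) ∈ Λ ↔ μ * (v : MWord d N) ∈ Λ) :
    checkers Λ T ≤ diagEq u v := by
  classical
  refine StarSubalgebra.topologicalClosure_minimal (StarAlgebra.adjoin_le ?_)
    (isClosed_diagEq u v)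
  rintro _ ⟨μ, hμ, rfl⟩
  have key : ∀ w, (star (T μ) * T μ) (evec Λ w) =
      (if μ * (w : MWord d N) ∈ Λ then (1 : ℂ) else 0) • evec Λ w := fun w => by
    rw [star_T_mul_T_apply hT1 hT2]
    split_ifs <;> simp
  refine ⟨isDiag_of_apply_eq_smul _ key, ?_⟩
  rw [apply_self_of_eq_smul (key u), apply_self_of_eq_smul (key v)]
  simp only [huv μ hμ]

theorem isDiag_of_mem_checkers {a : ell2 Λ →L[ℂ] ell2 Λ} (ha : a ∈ checkers Λ T) :
    IsDiag a := fun w =>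
  (checkers_le_diagEq hT1 hT2 w w (fun _ _ => Iff.rfl) ha).1 w

open Classical in
theorem exists_mem_checkers_apply (L : List (MWord d N)) (hL : ∀ μ ∈ L, μ ∈ Λ) :
    ∃ a ∈ checkers Λ T, ∀ w : Λ, a (evec Λ w) =
      if ∀ μ ∈ L, μ * (w : MWord d N) ∈ Λ then evec Λ w else 0 := by
  induction L with
  | nil => exact ⟨1, one_mem _, fun w => by simp⟩
  | cons μ L ih =>
    obtain ⟨a, ha, haw⟩ := ih fun ν hν => hL ν (List.mem_cons_of_mem _ hν)
    refine ⟨star (T μ) * T μ * a, mul_mem ?_ ha, fun w => ?_⟩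
    · exact StarSubalgebra.le_topologicalClosure _
        (StarAlgebra.subset_adjoin ℂ _ ⟨μ, hL μ List.mem_cons_self, rfl⟩)
    · rw [mul_apply_eq_comp, haw]
      by_cases h : ∀ ν ∈ L, ν * (w : MWord d N) ∈ Λ
      · rw [if_pos h, star_T_mul_T_apply hT1 hT2]
        simp only [List.forall_mem_cons, iff_true_intro h, and_true]
      · rw [if_neg h, map_zero, if_neg]
        exact fun h' => h fun ν hν => h' ν (List.mem_cons_of_mem _ hν)

open Classical in
theorem Pproj_apply (hFL : IsFL Λ) (i : Fin N) (w : Λ) :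
    Pproj Λ T i (evec Λ w) = if (w : MWord d N) i = 1 then 0 else evec Λ w := by
  classical
  simp only [Pproj, sum_apply, mul_apply_eq_comp]
  split_ifs with h
  · refine Finset.sum_eq_zero fun k _ => ?_
    rw [star_T_apply_of_forall_ne hT1 hT2, map_zero]
    intro v hv
    exact delta_mul_apply_ne_one i k v (hv ▸ h)
  · obtain ⟨k, v, hv⟩ := exists_eq_delta_mul h
    obtain ⟨w, hw⟩ := w
    dsimp only at hv
    subst hv
    rw [Finset.sum_eq_single k]
    · have := star_T_apply_mul hT1 hT2 (delta d N i k) ⟨v, hFL.right_mem hw⟩ hw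
      rw [this, hT1 _ ⟨v, hFL.right_mem hw⟩ hw]
    · intro l _ hl
      rw [star_T_apply_of_forall_ne hT1 hT2, map_zero]
      intro u hu
      exact hl (delta_mul_letter_injective hu).symm
    · simp

open Classical in
theorem Qproj_apply (hFL : IsFL Λ) (F : Finset (Fin N)) (w : Λ) :
    Qproj Λ T F (evec Λ w) = if ∀ i ∈ F, (w : MWord d N) i = 1 then evec Λ w else 0 := by
  have key : ∀ L : List (Fin N),
      L.foldr (fun i acc => (1 - Pproj Λ T i) * acc) 1 (evec Λ w) =
        if ∀ i ∈ L, (w : MWord d N) i = 1 then evec Λ w else 0 := by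
    intro L
    induction L with
    | nil => simp
    | cons i L ih =>
      rw [List.foldr_cons, mul_apply_eq_comp, ih]
      by_cases h : ∀ j ∈ L, (w : MWord d N) j = 1
      · rw [if_pos h, sub_apply, Pproj_apply hT1 hT2 hFL]
        by_cases hi : (w : MWord d N) i = 1
        · simp [hi, iff_true_intro h]
        · simp [hi]
      · rw [if_neg h, map_zero, if_neg]
        exact fun h' => h fun j hj => h' j (List.mem_cons_of_mem _ hj)
  rw [Qproj, key]
  simp

/-- Elements of `K_F` annihilate the basis vectors whose support meets `F`. -/
theorem apply_eq_zero_of_mem_Kset (hFL : IsFL Λ) {F : Finset (Fin N)}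
    {a : ell2 Λ →L[ℂ] ell2 Λ} (ha : a ∈ Kset Λ T F) {i : Fin N} (hi : i ∈ F) (w : Λ)
    (hw : (w : MWord d N) i ≠ 1) : a (evec Λ w) = 0 := by
  obtain ⟨k, v, hv⟩ := exists_eq_delta_mul hw
  obtain ⟨w, hwΛ⟩ := w
  dsimp only at hv
  subst hv
  have hd := isDiag_of_mem_checkers hT1 hT2 ha.1 ⟨_, hwΛ⟩
  have h := congrArg (fun b => b (evec Λ ⟨v, hFL.right_mem hwΛ⟩)) (ha.2 i hi k)
  simp only [mul_apply_eq_comp, zero_apply] at h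
  rw [hT1 _ ⟨v, hFL.right_mem hwΛ⟩ hwΛ, hd, map_smul,
    star_T_apply_mul hT1 hT2 _ ⟨v, hFL.right_mem hwΛ⟩ hwΛ] at h
  rw [hd, (smul_eq_zero.mp h).resolve_right (evec_ne_zero _), zero_smul]

/-- For `a ∈ K_F`, the compression `a Q_{F^c}` is a multiple of `Q_∅̄`. -/
theorem mul_Qproj_eq_smul_of_mem_Kset (hFL : IsFL Λ) {F : Finset (Fin N)}
    {Qe : ell2 Λ →L[ℂ] ell2 Λ}
    (hQe : ∀ w : Λ, ((w : MWord d N) = 1 → Qe (evec Λ w) = evec Λ w) ∧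
      ((w : MWord d N) ≠ 1 → Qe (evec Λ w) = 0))
    (h1 : (1 : MWord d N) ∈ Λ)
    {a : ell2 Λ →L[ℂ] ell2 Λ} (ha : a ∈ Kset Λ T F) :
    a * Qproj Λ T Fᶜ = (a (evec Λ ⟨1, h1⟩) : Λ → ℂ) ⟨1, h1⟩ • Qe := by
  refine ext_evec fun w => ?_
  rw [mul_apply_eq_comp, Qproj_apply hT1 hT2 hFL, smul_apply]
  by_cases hw : (w : MWord d N) = 1
  · obtain ⟨w, hwΛ⟩ := w
    dsimp only at hw
    subst hw
    rw [(hQe _).1 rfl, if_pos (by simp)]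
    exact isDiag_of_mem_checkers hT1 hT2 ha.1 _
  · rw [(hQe w).2 hw, smul_zero]
    split_ifs with h
    · obtain ⟨i, hi⟩ := Function.ne_iff.mp hw
      refine apply_eq_zero_of_mem_Kset hT1 hT2 hFL ha (i := i) ?_ w hi
      by_contra hiF
      exact hi (h i (Finset.mem_compl.mpr hiF))
    · exact map_zero _

theorem exists_mul_delta_notMem (hFL : IsFL Λ) {F : Finset (Fin N)}
    {Qe : ell2 Λ →L[ℂ] ell2 Λ}
    (hQe : ∀ w : Λ, ((w : MWord d N) = 1 → Qe (evec Λ w) = evec Λ w) ∧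
      ((w : MWord d N) ≠ 1 → Qe (evec Λ w) = 0))
    (h1 : (1 : MWord d N) ∈ Λ)
    {a : ell2 Λ →L[ℂ] ell2 Λ} (ha : a ∈ checkers Λ T) (haQ : a * Qproj Λ T Fᶜ = Qe)
    {i : Fin N} (hi : i ∈ F) {k : Fin d} (hk : delta d N i k ∈ Λ) :
    ∃ μ ∈ Λ, μ * delta d N i k ∉ Λ := by
  by_contra! hcon
  have heq := (checkers_le_diagEq hT1 hT2 ⟨1, h1⟩ ⟨_, hk⟩
    (fun μ hμ => by simp [hμ, hcon μ hμ]) ha).2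
  have hQ : ∀ w : Λ, (∀ j ∈ Fᶜ, (w : MWord d N) j = 1) → a (evec Λ w) = Qe (evec Λ w) := by
    intro w hw
    rw [← haQ, mul_apply_eq_comp, Qproj_apply hT1 hT2 hFL, if_pos hw]
  have hδ : delta d N i k ≠ 1 := by
    have := delta_mul_apply_ne_one i k (1 : MWord d N)
    rw [mul_one] at this
    exact fun h => this (congrFun h i)
  rw [hQ ⟨1, h1⟩ (fun _ _ => rfl), (hQe ⟨1, h1⟩).1 rfl, evec_apply_self,
    hQ ⟨_, hk⟩ ?_, (hQe ⟨_, hk⟩).2 hδ] at heq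
  · simp at heq
  · intro j hj
    have : j ≠ i := by
      rintro rfl
      exact Finset.mem_compl.mp hj hi
    simp [delta, this]

theorem exists_mem_Kset_mul_Qproj_ne_zero (hFL : IsFL Λ) {F : Finset (Fin N)}
    (h1 : (1 : MWord d N) ∈ Λ)
    (h : ∀ i ∈ F, ∀ k : Fin d, delta d N i k ∈ Λ → ∃ μ ∈ Λ, μ * delta d N i k ∉ Λ) :
    ∃ a ∈ Kset Λ T F, a * Qproj Λ T Fᶜ ≠ 0 := by
  classical
  have h' : ∀ p : Fin N × Fin d, ∃ μ ∈ Λ,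
      p.1 ∈ F → delta d N p.1 p.2 ∈ Λ → μ * delta d N p.1 p.2 ∉ Λ := by
    intro p
    by_cases hp : p.1 ∈ F ∧ delta d N p.1 p.2 ∈ Λ
    · obtain ⟨μ, hμ, hμ'⟩ := h p.1 hp.1 p.2 hp.2
      exact ⟨μ, hμ, fun _ _ => hμ'⟩
    · exact ⟨1, h1, fun h2 h3 => absurd ⟨h2, h3⟩ hp⟩
  choose m hm hm' using h'
  obtain ⟨a, ha, haw⟩ := exists_mem_checkers_apply hT1 hT2
    ((Finset.univ : Finset (Fin N × Fin d)).toList.map m) fun μ hμ => by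
      obtain ⟨p, -, rfl⟩ := List.mem_map.mp hμ
      exact hm p
  refine ⟨a, ⟨ha, fun i hi k => ext_evec fun w => ?_⟩, fun h0 => ?_⟩
  · simp only [mul_apply_eq_comp, zero_apply]
    by_cases hw : delta d N i k * (w : MWord d N) ∈ Λ
    · rw [hT1 _ w hw, haw, if_neg, map_zero]
      intro hall
      have := hall (m (i, k)) (List.mem_map_of_mem (by simp))
      rw [← mul_assoc] at this
      exact hm' (i, k) hi (hFL.left_mem hw) (hFL.left_mem this)
    · rw [hT2 _ w hw, map_zero, map_zero]
  · have := congrArg (fun b => b (evec Λ ⟨1, h1⟩)) h0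
    simp only [mul_apply_eq_comp, zero_apply] at this
    rw [Qproj_apply hT1 hT2 hFL, if_pos (by simp), haw, if_pos] at this
    · exact evec_ne_zero _ this
    · intro μ hμ
      obtain ⟨p, -, rfl⟩ := List.mem_map.mp hμ
      simpa using hm p

end Operators

end

/-- For a factorial language `Λ*` and `∅ ≠ F ⊆ [N]`, with `Q_∅̄` the rank-one orthogonal
projection onto `ℂ e_∅̄`, the following are equivalent:
(i) there exists `a ∈ K_F` with `a Q_{F^c} ≠ 0`;
(ii) there exists `a ∈ A` with `a Q_{F^c} = Q_∅̄`;
(iii) for every `i ∈ F` and `k ∈ [d]` with `δ_i(k) ∈ Λ*` there exists `μ̄ ∈ Λ*` with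
`μ̄ * δ_i(k) ∉ Λ*`. -/
theorem Kset_nonzero_compression_tfae {d N : ℕ} (Λ : Set (MWord d N)) (hFL : IsFL Λ)
    (T : MWord d N → (ell2 Λ →L[ℂ] ell2 Λ))
    (hT1 : ∀ (μ : MWord d N) (w : Λ) (h : μ * (w : MWord d N) ∈ Λ),
      T μ (evec Λ w) = evec Λ ⟨μ * (w : MWord d N), h⟩)
    (hT2 : ∀ (μ : MWord d N) (w : Λ), μ * (w : MWord d N) ∉ Λ → T μ (evec Λ w) = 0)
    (Qe : ell2 Λ →L[ℂ] ell2 Λ)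
    (hQe : ∀ w : Λ, ((w : MWord d N) = 1 → Qe (evec Λ w) = evec Λ w) ∧
      ((w : MWord d N) ≠ 1 → Qe (evec Λ w) = 0))
    (F : Finset (Fin N)) (hF : F.Nonempty) :
    ((∃ a ∈ Kset Λ T F, a * Qproj Λ T Fᶜ ≠ 0) ↔
      (∃ a ∈ checkers Λ T, a * Qproj Λ T Fᶜ = Qe)) ∧
    ((∃ a ∈ checkers Λ T, a * Qproj Λ T Fᶜ = Qe) ↔
      (∀ i ∈ F, ∀ k : Fin d, delta d N i k ∈ Λ →
        ∃ μ ∈ Λ, μ * delta d N i k ∉ Λ)) := by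
  obtain ⟨i₀, -⟩ := id hF
  obtain ⟨k₀, hk₀⟩ := hFL.1 i₀
  have h1 : (1 : MWord d N) ∈ Λ := hFL.left_mem (w := delta d N i₀ k₀) (by rwa [one_mul])
  have h12 : (∃ a ∈ Kset Λ T F, a * Qproj Λ T Fᶜ ≠ 0) →
      ∃ a ∈ checkers Λ T, a * Qproj Λ T Fᶜ = Qe := by
    rintro ⟨a, ha, ha0⟩
    have hmul := mul_Qproj_eq_smul_of_mem_Kset hT1 hT2 hFL hQe h1 ha
    have hc : (a (evec Λ ⟨1, h1⟩) : Λ → ℂ) ⟨1, h1⟩ ≠ 0 := fun hc => ha0 <| by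
      rw [hmul, hc, zero_smul]
    refine ⟨((a (evec Λ ⟨1, h1⟩) : Λ → ℂ) ⟨1, h1⟩)⁻¹ • a,
      SMulMemClass.smul_mem _ ha.1, ?_⟩
    rw [smul_mul_assoc, hmul, inv_smul_smul₀ hc]
  have h23 : (∃ a ∈ checkers Λ T, a * Qproj Λ T Fᶜ = Qe) →
      ∀ i ∈ F, ∀ k : Fin d, delta d N i k ∈ Λ → ∃ μ ∈ Λ, μ * delta d N i k ∉ Λ := by
    rintro ⟨a, ha, haQ⟩ i hi k hk
    exact exists_mul_delta_notMem hT1 hT2 hFL hQe h1 ha haQ hi hk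
  have h31 := exists_mem_Kset_mul_Qproj_ne_zero hT1 hT2 hFL (F := F) h1
  exact ⟨⟨h12, fun h => h31 (h23 h)⟩, ⟨h23, fun h => h12 (h31 h)⟩⟩

end
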